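/- arXiv:1103.4681 — 4 statements merged into one kernel-verified Lean document; each statement's English description precedes it below -/
import Mathlib

section
/- Let N ≥ 1 and let 0 < M < N be an integer. For every real N × N matrix (d_ij), there exists π* ∈ P_M with all entries in {0, 1} such that Σ_{i,j} d_ij π*_ij ≤ Σ_{i,j} d_ij π_ij for every π ∈ P_M. -/
open Finset

section Blocks

variable {n k : Type*} [Fintype n] [Fintype k] [DecidableEq n] [DecidableEq k]

lemma sum_toBlocks₁₁_of_mem_doublyStochastic {A : Matrix (n ⊕ k) (n ⊕ k) ℝ}
    (hA : A ∈ doublyStochastic ℝ (n ⊕ k)) (h0 : A.toBlocks₂₂ = 0) :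
    ∑ i, ∑ j, A.toBlocks₁₁ i j = (Fintype.card n : ℝ) - Fintype.card k := by
  obtain ⟨-, hr, hc⟩ := mem_doublyStochastic_iff_sum.1 hA
  have h0' (a b : k) : A (.inr a) (.inr b) = 0 := congrFun (congrFun h0 a) b
  have h1 : ∑ i : n, ∑ j, A (.inl i) j = Fintype.card n := by simp [hr]
  have h2 : ∑ j : k, ∑ i, A i (.inr j) = Fintype.card k := by simp [hc]
  simp only [Fintype.sum_sum_type, h0', sum_const_zero, add_zero, sum_add_distrib] at h1 h2
  rw [sum_comm] at h2
  simp only [Matrix.toBlocks₁₁, Matrix.of_apply]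
  linarith

lemma toBlocks₁₁_row_sum_le_one {A : Matrix (n ⊕ k) (n ⊕ k) ℝ}
    (hA : A ∈ doublyStochastic ℝ (n ⊕ k)) (i : n) : ∑ j, A.toBlocks₁₁ i j ≤ 1 := by
  obtain ⟨h0, hr, -⟩ := mem_doublyStochastic_iff_sum.1 hA
  rw [← hr (.inl i), Fintype.sum_sum_type]
  exact le_add_of_nonneg_right (sum_nonneg fun _ _ => h0 _ _)

lemma toBlocks₁₁_col_sum_le_one {A : Matrix (n ⊕ k) (n ⊕ k) ℝ}
    (hA : A ∈ doublyStochastic ℝ (n ⊕ k)) (j : n) : ∑ i, A.toBlocks₁₁ i j ≤ 1 := by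
  obtain ⟨h0, -, hc⟩ := mem_doublyStochastic_iff_sum.1 hA
  rw [← hc (.inl j), Fintype.sum_sum_type]
  exact le_add_of_nonneg_right (sum_nonneg fun _ _ => h0 _ _)

/-- A doubly substochastic matrix whose entries sum to `card n - card k` is the upper left block
of a doubly stochastic matrix with vanishing lower right block. -/
lemma exists_mem_doublyStochastic_toBlocks₁₁_eq [Nonempty k] {π : Matrix n n ℝ}
    (h0 : ∀ i j, 0 ≤ π i j) (hc : ∀ j, ∑ i, π i j ≤ 1) (hr : ∀ i, ∑ j, π i j ≤ 1)
    (hs : ∑ i, ∑ j, π i j = (Fintype.card n : ℝ) - Fintype.card k) :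
    ∃ A ∈ doublyStochastic ℝ (n ⊕ k), A.toBlocks₁₁ = π ∧ A.toBlocks₂₂ = 0 := by
  have hk : (Fintype.card k : ℝ) ≠ 0 := by simp
  refine ⟨.fromBlocks π (.of fun i _ => (1 - ∑ j, π i j) / Fintype.card k)
    (.of fun _ j => (1 - ∑ i, π i j) / Fintype.card k) 0,
    mem_doublyStochastic_iff_sum.2 ⟨?_, ?_, ?_⟩, by simp, by simp⟩
  · rintro (i | i) (j | j)
    · exact h0 i j
    · exact div_nonneg (sub_nonneg.2 (hr i)) (Nat.cast_nonneg _)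
    · exact div_nonneg (sub_nonneg.2 (hc j)) (Nat.cast_nonneg _)
    · exact le_rfl
  · rintro (i | i)
    · simp [Fintype.sum_sum_type, mul_div_cancel₀, hk]
    · have hs' : ∑ j, ∑ i, π i j = (Fintype.card n : ℝ) - Fintype.card k := sum_comm.trans hs
      simp [Fintype.sum_sum_type, ← sum_div, hs']
  · rintro (j | j)
    · simp [Fintype.sum_sum_type, mul_div_cancel₀, hk]
    · simp [Fintype.sum_sum_type, ← sum_div, hs]

/-- A doubly substochastic matrix whose entries sum to `card n - card k` is a convex combination
of upper left blocks of permutation matrices with vanishing lower right block. -/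
lemma exists_eq_sum_toBlocks₁₁_permMatrix [Nonempty k] {π : Matrix n n ℝ}
    (h0 : ∀ i j, 0 ≤ π i j) (hc : ∀ j, ∑ i, π i j ≤ 1) (hr : ∀ i, ∑ j, π i j ≤ 1)
    (hs : ∑ i, ∑ j, π i j = (Fintype.card n : ℝ) - Fintype.card k) :
    ∃ w : Equiv.Perm (n ⊕ k) → ℝ, (∀ σ, 0 ≤ w σ) ∧ ∑ σ, w σ = 1 ∧
      (∀ i j, π i j = ∑ σ, w σ * (σ.permMatrix ℝ).toBlocks₁₁ i j) ∧
      ∀ σ, w σ ≠ 0 → (σ.permMatrix ℝ).toBlocks₂₂ = 0 := by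
  obtain ⟨A, hA, rfl, hA0⟩ := exists_mem_doublyStochastic_toBlocks₁₁_eq (k := k) h0 hc hr hs
  obtain ⟨w, hw0, hw1, rfl⟩ := exists_eq_sum_perm_of_mem_doublyStochastic hA
  refine ⟨w, hw0, hw1, fun i j => by simp [Matrix.toBlocks₁₁, Matrix.sum_apply], ?_⟩
  intro σ hσ
  ext a b
  have hab := congrFun (congrFun hA0 a) b
  simp only [Matrix.toBlocks₂₂, Matrix.of_apply, Matrix.sum_apply, Matrix.smul_apply,
    smul_eq_mul, Matrix.zero_apply] at hab ⊢
  rw [sum_eq_zero_iff_of_nonneg fun τ _ => mul_nonneg (hw0 τ)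
    (nonneg_of_mem_doublyStochastic permMatrix_mem_doublyStochastic)] at hab
  exact (mul_eq_zero.1 (hab σ (mem_univ σ))).resolve_left hσ

end Blocks

/-- Over the polytope `P_M` of nonnegative `N × N` matrices with row and column sums at most
`1` and total sum `M < N`, the linear functional `π ↦ ∑ d_ij π_ij` attains its minimum at a
matrix all of whose entries are `0` or `1`. -/
theorem partial_transport_min_at_zero_one (N M : ℕ) (hN : 1 ≤ N) (hM0 : 0 < M) (hMN : M < N)
    (d : Matrix (Fin N) (Fin N) ℝ) :
    ∃ τ : Matrix (Fin N) (Fin N) ℝ,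
      (∀ i j, 0 ≤ τ i j) ∧
      (∀ j, ∑ i, τ i j ≤ 1) ∧
      (∀ i, ∑ j, τ i j ≤ 1) ∧
      (∑ i, ∑ j, τ i j = (M : ℝ)) ∧
      (∀ i j, τ i j = 0 ∨ τ i j = 1) ∧
      ∀ π : Matrix (Fin N) (Fin N) ℝ,
        (∀ i j, 0 ≤ π i j) → (∀ j, ∑ i, π i j ≤ 1) → (∀ i, ∑ j, π i j ≤ 1) →
        (∑ i, ∑ j, π i j = (M : ℝ)) →
        ∑ i, ∑ j, d i j * τ i j ≤ ∑ i, ∑ j, d i j * π i j := by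
  classical
  have hk : 0 < N - M := by omega
  have : Nonempty (Fin (N - M)) := ⟨⟨0, hk⟩⟩
  have hcard : (M : ℝ) = (Fintype.card (Fin N) : ℝ) - Fintype.card (Fin (N - M)) := by
    simp [Nat.cast_sub hMN.le]
  have hN0 : (0 : ℝ) < N := by exact_mod_cast hN
  have hMN' : (M : ℝ) ≤ N := by exact_mod_cast hMN.le
  let T (σ : Equiv.Perm (Fin N ⊕ Fin (N - M))) : Matrix (Fin N) (Fin N) ℝ :=
    (σ.permMatrix ℝ).toBlocks₁₁
  let S : Finset (Equiv.Perm (Fin N ⊕ Fin (N - M))) :=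
    univ.filter fun σ => (σ.permMatrix ℝ).toBlocks₂₂ = 0
  have hS : S.Nonempty := by
    have hrow : ∑ _j : Fin N, (M : ℝ) / N ^ 2 ≤ 1 := by
      simp only [sum_const, card_univ, Fintype.card_fin, nsmul_eq_mul]
      field_simp
      exact hMN'
    obtain ⟨w, -, hw1, -, hw⟩ := exists_eq_sum_toBlocks₁₁_permMatrix (k := Fin (N - M))
      (π := .of fun _ _ : Fin N => (M : ℝ) / N ^ 2) (fun _ _ => by simp; positivity)
      (fun _ => by simpa using hrow) (fun _ => by simpa using hrow) (by
        rw [← hcard]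
        simp only [Matrix.of_apply, sum_const, card_univ, Fintype.card_fin, nsmul_eq_mul]
        field_simp)
    obtain ⟨σ, -, hσ⟩ := exists_ne_zero_of_sum_ne_zero (hw1.trans_ne one_ne_zero)
    exact ⟨σ, by simpa [S] using hw σ hσ⟩
  obtain ⟨σ, hσS, hσ⟩ := S.exists_min_image (fun σ => ∑ i, ∑ j, d i j * T σ i j) hS
  have hmem : σ.permMatrix ℝ ∈ doublyStochastic ℝ (Fin N ⊕ Fin (N - M)) :=
    permMatrix_mem_doublyStochastic
  refine ⟨T σ, fun i j => nonneg_of_mem_doublyStochastic hmem,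
    toBlocks₁₁_col_sum_le_one hmem, toBlocks₁₁_row_sum_le_one hmem, ?_, fun i j => ?_, ?_⟩
  · rw [hcard]
    exact sum_toBlocks₁₁_of_mem_doublyStochastic hmem (mem_filter.1 hσS).2
  · simp only [T, Matrix.toBlocks₁₁, Matrix.of_apply, Equiv.Perm.permMatrix,
      PEquiv.toMatrix_apply]
    exact (ite_eq_or_eq _ _ _).symm
  · intro π h0 hc hr hs
    obtain ⟨w, hw0, hw1, hπ, hw⟩ :=
      exists_eq_sum_toBlocks₁₁_permMatrix (k := Fin (N - M)) h0 hc hr (hs.trans hcard)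
    calc ∑ i, ∑ j, d i j * T σ i j
        = ∑ ρ, w ρ * ∑ i, ∑ j, d i j * T σ i j := by rw [← sum_mul, hw1, one_mul]
      _ ≤ ∑ ρ, w ρ * ∑ i, ∑ j, d i j * T ρ i j := by
        refine sum_le_sum fun ρ _ => ?_
        by_cases hρ : w ρ = 0
        · simp [hρ]
        · exact mul_le_mul_of_nonneg_left (hσ ρ (by simpa [S] using hw ρ hρ)) (hw0 ρ)
      _ = ∑ i, ∑ j, d i j * π i j := by
        simp only [hπ, mul_sum]
        rw [sum_comm]
        refine sum_congr rfl fun i _ => ?_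
        rw [sum_comm]
        exact sum_congr rfl fun j _ => sum_congr rfl fun ρ _ => mul_left_comm _ _ _
end

section
/- Let N ≥ 1 and let 0 < M < N be an integer. The set P_M is a convex polytope, and a matrix π ∈ P_M is an extreme point of P_M if and only if every entry of π lies in {0, 1}. -/
open Finset

/-- The polytope `P_M` of nonnegative `N × N` real matrices with row and column sums at most
`1` and total sum equal to `M`. -/
def PMset (N M : ℕ) : Set (Matrix (Fin N) (Fin N) ℝ) :=
  {π | (∀ i j, 0 ≤ π i j) ∧ (∀ j, ∑ i, π i j ≤ 1) ∧ (∀ i, ∑ j, π i j ≤ 1) ∧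
    ∑ i, ∑ j, π i j = (M : ℝ)}

lemma convex_PMset (N M : ℕ) : Convex ℝ (PMset N M) := by
  rintro x ⟨hx0, hxc, hxr, hxs⟩ y ⟨hy0, hyc, hyr, hys⟩ a b ha hb hab
  refine ⟨fun i j => ?_, fun j => ?_, fun i => ?_, ?_⟩
  · have := hx0 i j
    have := hy0 i j
    simp only [Matrix.add_apply, Matrix.smul_apply, smul_eq_mul]
    positivity
  · simp only [Matrix.add_apply, Matrix.smul_apply, smul_eq_mul, sum_add_distrib, ← mul_sum]
    nlinarith [mul_le_mul_of_nonneg_left (hxc j) ha, mul_le_mul_of_nonneg_left (hyc j) hb]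
  · simp only [Matrix.add_apply, Matrix.smul_apply, smul_eq_mul, sum_add_distrib, ← mul_sum]
    nlinarith [mul_le_mul_of_nonneg_left (hxr i) ha, mul_le_mul_of_nonneg_left (hyr i) hb]
  · simp only [Matrix.add_apply, Matrix.smul_apply, smul_eq_mul, sum_add_distrib, ← mul_sum,
      hxs, hys, ← add_mul, hab, one_mul]

lemma PMset_apply_le_one {N M : ℕ} {π : Matrix (Fin N) (Fin N) ℝ} (hπ : π ∈ PMset N M)
    (i j : Fin N) : π i j ≤ 1 :=
  (single_le_sum (f := fun j => π i j) (fun k _ => hπ.1 i k) (mem_univ j)).trans (hπ.2.2.1 i)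

lemma isClosed_PMset (N M : ℕ) : IsClosed (PMset N M) := by
  simp only [PMset, Set.ofPred_and, Set.ofPred_forall]
  refine .inter (isClosed_iInter fun i => isClosed_iInter fun j => ?_) <|
    .inter (isClosed_iInter fun j => ?_) <| .inter (isClosed_iInter fun i => ?_) ?_
  · exact isClosed_le (by fun_prop) (by fun_prop)
  · exact isClosed_le (by fun_prop) (by fun_prop)
  · exact isClosed_le (by fun_prop) (by fun_prop)
  · exact isClosed_eq (by fun_prop) (by fun_prop)

lemma isCompact_PMset (N M : ℕ) : IsCompact (PMset N M) := by
  have hbox : IsCompact (Set.univ.pi fun _ => Set.univ.pi fun _ => Set.Icc 0 1 :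
      Set (Fin N → Fin N → ℝ)) :=
    isCompact_univ_pi fun _ => isCompact_univ_pi fun _ => isCompact_Icc
  exact hbox.of_isClosed_subset (isClosed_PMset N M) fun π hπ i _ j _ =>
    ⟨hπ.1 i j, PMset_apply_le_one hπ i j⟩

/-- A square matrix of size `N` bordered by `N - M` copies of the row and column defects, scaled
so as to be doubly stochastic when the matrix lies in `PMset N M`. -/
noncomputable def doublyStochasticExtension {N : ℕ} (M : ℕ) (π : Matrix (Fin N) (Fin N) ℝ) :
    Matrix (Fin N ⊕ Fin (N - M)) (Fin N ⊕ Fin (N - M)) ℝ :=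
  Matrix.fromBlocks π (.of fun i _ => (1 - ∑ j, π i j) / (N - M))
    (.of fun _ j => (1 - ∑ i, π i j) / (N - M)) 0

lemma doublyStochasticExtension_mem {N M : ℕ} (hMN : M < N) {π : Matrix (Fin N) (Fin N) ℝ}
    (hπ : π ∈ PMset N M) :
    doublyStochasticExtension M π ∈ doublyStochastic ℝ (Fin N ⊕ Fin (N - M)) := by
  obtain ⟨h0, hc, hr, hs⟩ := hπ
  have hpos : (0 : ℝ) < N - M := sub_pos.2 (by exact_mod_cast hMN)
  have hs' : ∑ j, ∑ i, π i j = (M : ℝ) := by rw [sum_comm, hs]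
  rw [mem_doublyStochastic_iff_sum]
  refine ⟨?_, ?_, ?_⟩
  · rintro (i | i) (j | j)
    · exact h0 i j
    · exact div_nonneg (sub_nonneg.2 (hr i)) hpos.le
    · exact div_nonneg (sub_nonneg.2 (hc j)) hpos.le
    · exact le_rfl
  · rintro (i | i)
    · simp [doublyStochasticExtension, Nat.cast_sub hMN.le, mul_div_cancel₀ _ hpos.ne']
    · simp [doublyStochasticExtension, ← sum_div, hs', hpos.ne']
  · rintro (j | j)
    · simp [doublyStochasticExtension, Nat.cast_sub hMN.le, mul_div_cancel₀ _ hpos.ne']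
    · simp [doublyStochasticExtension, ← sum_div, hs, hpos.ne']

lemma toBlocks₁₁_mem_PMset {N M : ℕ} (hMN : M < N)
    {A : Matrix (Fin N ⊕ Fin (N - M)) (Fin N ⊕ Fin (N - M)) ℝ}
    (hA : A ∈ doublyStochastic ℝ (Fin N ⊕ Fin (N - M)))
    (hzero : ∀ i j, A (.inr i) (.inr j) = 0) : A.toBlocks₁₁ ∈ PMset N M := by
  obtain ⟨h0, hr, hc⟩ := mem_doublyStochastic_iff_sum.1 hA
  simp only [Fintype.sum_sum_type] at hr hc
  refine ⟨fun i j => h0 _ _, fun j => ?_, fun i => ?_, ?_⟩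
  · rw [← hc (.inl j)]
    exact le_add_of_nonneg_right (sum_nonneg fun _ _ => h0 _ _)
  · rw [← hr (.inl i)]
    exact le_add_of_nonneg_right (sum_nonneg fun _ _ => h0 _ _)
  · have hrow : ∑ i : Fin N, (∑ j : Fin N, A (.inl i) (.inl j) +
        ∑ j : Fin (N - M), A (.inl i) (.inr j)) = N := by
      simp [fun i => hr (.inl i)]
    have hcol : ∑ j : Fin (N - M), ∑ i : Fin N, A (.inl i) (.inr j) = (N : ℝ) - M := by
      have := fun j => hc (.inr j)
      simp only [hzero, sum_const_zero, add_zero] at this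
      simp [this, Nat.cast_sub hMN.le]
    rw [sum_add_distrib, sum_comm (γ := Fin N) (α := Fin (N - M)), hcol] at hrow
    simp only [Matrix.toBlocks₁₁, Matrix.of_apply]
    linarith

/-- By Birkhoff's theorem, every point of the polytope is a convex combination of
`0`-`1` matrices lying in it. -/
lemma PMset_subset_convexHull {N M : ℕ} (hMN : M < N) :
    PMset N M ⊆ convexHull ℝ {A ∈ PMset N M | ∀ i j, A i j = 0 ∨ A i j = 1} := by
  intro π hπ
  obtain ⟨w, hw0, hw1, hw⟩ :=
    exists_eq_sum_perm_of_mem_doublyStochastic (doublyStochasticExtension_mem hMN hπ)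
  have hsum : π = ∑ σ with w σ ≠ 0, w σ • (σ.permMatrix ℝ).toBlocks₁₁ := by
    rw [sum_filter_of_ne fun σ _ => left_ne_zero_of_smul]
    ext i j
    have := congr_fun₂ hw (.inl i) (.inl j)
    simp only [doublyStochasticExtension, Matrix.fromBlocks_apply₁₁, Matrix.sum_apply,
      Matrix.smul_apply] at this ⊢
    exact this.symm
  rw [hsum]
  refine (convex_convexHull ℝ _).sum_mem (fun σ _ => hw0 σ) (by rwa [sum_filter_ne_zero])
    fun σ hσ => subset_convexHull ℝ _ ⟨?_, fun i j => ?_⟩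
  · refine toBlocks₁₁_mem_PMset hMN permMatrix_mem_doublyStochastic fun i j => ?_
    have := congr_fun₂ hw (.inr i) (.inr j)
    simp only [doublyStochasticExtension, Matrix.fromBlocks_apply₂₂, Matrix.sum_apply,
      Matrix.smul_apply, Matrix.zero_apply, smul_eq_mul] at this
    rw [sum_eq_zero_iff_of_nonneg fun τ _ => mul_nonneg (hw0 τ)
      (nonneg_of_mem_doublyStochastic permMatrix_mem_doublyStochastic)] at this
    exact (mul_eq_zero.1 (this σ (mem_univ σ))).resolve_left (mem_filter.1 hσ).2
  · simp only [Matrix.toBlocks₁₁, Matrix.of_apply, Equiv.Perm.permMatrix,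
      PEquiv.toMatrix_apply]
    split_ifs <;> simp

lemma mem_extremePoints_PMset_of_zero_or_one {N M : ℕ} {π : Matrix (Fin N) (Fin N) ℝ}
    (hπ : π ∈ PMset N M) (h01 : ∀ i j, π i j = 0 ∨ π i j = 1) :
    π ∈ Set.extremePoints ℝ (PMset N M) := by
  refine ⟨hπ, fun x hx y hy ⟨a, b, ha, hb, hab, hxy⟩ => ?_⟩
  ext i j
  have hij : a * x i j + b * y i j = π i j := congr_fun₂ hxy i j
  have hx0 := hx.1 i j
  have hy0 := hy.1 i j
  have hx1 := PMset_apply_le_one hx i j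
  have hy1 := PMset_apply_le_one hy i j
  rcases h01 i j with h | h <;> rw [h] at hij ⊢
  · have := mul_nonneg hb.le hy0
    exact le_antisymm (by nlinarith) hx0
  · have := mul_le_mul_of_nonneg_left hy1 hb.le
    exact le_antisymm hx1 (by nlinarith)

/-- `P_M` is a convex polytope (convex and compact), and a matrix `π ∈ P_M` is an extreme
point of `P_M` if and only if all its entries lie in `{0, 1}`. -/
theorem PM_convex_and_extremePoints (N M : ℕ) (hN : 1 ≤ N) (hM0 : 0 < M) (hMN : M < N) :
    Convex ℝ (PMset N M) ∧ IsCompact (PMset N M) ∧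
      ∀ π ∈ PMset N M,
        (π ∈ Set.extremePoints ℝ (PMset N M) ↔ ∀ i j, π i j = 0 ∨ π i j = 1) := by
  refine ⟨convex_PMset N M, isCompact_PMset N M, fun π hπ =>
    ⟨fun h => ?_, mem_extremePoints_PMset_of_zero_or_one hπ⟩⟩
  have hhull := (PMset_subset_convexHull hMN).antisymm
    (convexHull_min (Set.sep_subset _ _) (convex_PMset N M))
  rw [hhull] at h
  exact (extremePoints_convexHull_subset h).2
end

section
/- Let (X, d_X) and (Y, d_Y) be compact metric spaces with Borel probability measures μ and ν, and let c : X × Y → [0, ∞) be uniformly continuous. Then for every ε > 0 there exists δ > 0 such that for all finite sets S ⊆ X and T ⊆ Y with measurable Voronoi cells and max(φ_X(S), φ_Y(T)) < δ, one has |T_c(μ, ν) − T_c(μ_S, ν_T)| ≤ ε; i.e., T_c(μ_S, ν_T) → T_c(μ, ν) as max(φ_X(S), φ_Y(T)) → 0. -/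
open MeasureTheory

/-- `{V i}` is a collection of Voronoi cells for the finite point set `{s i}`:
pairwise disjoint sets covering `X` with `O_i ⊆ V_i ⊆ C_i`. -/
def IsVoronoi {X : Type*} [MetricSpace X] {m : ℕ} (s : Fin m → X) (V : Fin m → Set X) : Prop :=
  Pairwise (Function.onFun Disjoint V) ∧ (⋃ i, V i) = Set.univ ∧
    ∀ i, {x : X | ∀ j, j ≠ i → dist x (s i) < dist x (s j)} ⊆ V i ∧
      V i ⊆ {x : X | ∀ j, j ≠ i → dist x (s i) ≤ dist x (s j)}

/-- The fill distance of the finite point set `{s i}` in `X`: the supremum of the radii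
`r > 0` such that some open ball of radius `r` contains no point of the set. -/
noncomputable def fillDist {X : Type*} [MetricSpace X] {m : ℕ} (s : Fin m → X) : ℝ :=
  sSup {r : ℝ | 0 < r ∧ ∃ x : X, ∀ i, r ≤ dist x (s i)}

/-- The discrete measure `μ_S = ∑ i μ(V i) δ_{s i}` associated to a measure `μ`, points
`{s i}` and Voronoi cells `{V i}`. -/
noncomputable def discMeas {X : Type*} [MeasurableSpace X] (μ : Measure X)
    {m : ℕ} (s : Fin m → X) (V : Fin m → Set X) : Measure X :=
  ∑ i, μ (V i) • Measure.dirac (s i)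

/-- `Π(μ, ν)`: Borel probability measures on `X × Y` with marginals `μ` and `ν`. -/
def Plans {X Y : Type*} [MeasurableSpace X] [MeasurableSpace Y]
    (μ : Measure X) (ν : Measure Y) : Set (Measure (X × Y)) :=
  {π | IsProbabilityMeasure π ∧ π.map Prod.fst = μ ∧ π.map Prod.snd = ν}

/-- The optimal transport cost `T_c(μ, ν) = inf_{π ∈ Π(μ,ν)} ∫ c dπ`. -/
noncomputable def Tcost {X Y : Type*} [MeasurableSpace X] [MeasurableSpace Y]
    (c : X × Y → ℝ) (μ : Measure X) (ν : Measure Y) : ℝ :=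
  sInf {t : ℝ | ∃ π ∈ Plans μ ν, t = ∫ q, c q ∂π}

/-- The modulus of continuity `ω_c(α) = sup { |c(x,y) - c(x',y')| : d(x,x') + d(y,y') < α }`. -/
noncomputable def omegaMod {X Y : Type*} [MetricSpace X] [MetricSpace Y]
    (c : X × Y → ℝ) (α : ℝ) : ℝ :=
  sSup {t : ℝ | ∃ x x' y y', dist x x' + dist y y' < α ∧ t = |c (x, y) - c (x', y')|}

open ProbabilityTheory

/-- Two couplings of pairs of measures that are concentrated near the diagonal allow a transport
plan between the first measures to be replaced by a plan between the second ones at small cost. -/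
theorem exists_plan_integral_le {X Y : Type*} [MetricSpace X] [MetricSpace Y]
    [CompactSpace X] [CompactSpace Y]
    [MeasurableSpace X] [BorelSpace X] [MeasurableSpace Y] [BorelSpace Y]
    {c : X × Y → ℝ} (hc : Continuous c) {δ ε : ℝ}
    (hδ : ∀ q q' : X × Y, dist q.1 q'.1 < δ → dist q.2 q'.2 < δ → c q ≤ c q' + ε)
    {γ : Measure (X × X)} {η : Measure (Y × Y)} [IsProbabilityMeasure γ] [IsProbabilityMeasure η]
    (hγ : ∀ᵐ p ∂γ, dist p.2 p.1 < δ) (hη : ∀ᵐ p ∂η, dist p.2 p.1 < δ)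
    {π : Measure (X × Y)} (hπ : π ∈ Plans γ.fst η.fst) :
    ∃ π' ∈ Plans γ.snd η.snd, ∫ q, c q ∂π' ≤ ∫ q, c q ∂π + ε := by
  obtain ⟨hprob, hπ1, hπ2⟩ := hπ
  have : Nonempty (X × Y) := nonempty_of_isProbabilityMeasure π
  have : Nonempty X := this.map Prod.fst
  have : Nonempty Y := Nonempty.map Prod.snd ‹Nonempty (X × Y)›
  have hγd : γ.fst ⊗ₘ γ.condKernel = γ := γ.disintegrate γ.condKernel
  have hηd : η.fst ⊗ₘ η.condKernel = η := η.disintegrate η.condKernel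
  set κ := γ.condKernel
  set l := η.condKernel
  set ρ : Measure ((X × Y) × (X × Y)) := π ⊗ₘ (κ ∥ₖ l) with hρ
  have hclose : ∀ᵐ r ∂ρ, c r.2 ≤ c r.1 + ε := by
    rw [hρ, Measure.ae_compProd_iff (measurableSet_le (by fun_prop) (by fun_prop))]
    have h1 : ∀ᵐ x ∂γ.fst, ∀ᵐ x' ∂κ x, dist x' x < δ :=
      Measure.ae_ae_of_ae_compProd (p := fun p : X × X => dist p.2 p.1 < δ) (by rwa [hγd])
    have h2 : ∀ᵐ y ∂η.fst, ∀ᵐ y' ∂l y, dist y' y < δ :=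
      Measure.ae_ae_of_ae_compProd (p := fun p : Y × Y => dist p.2 p.1 < δ) (by rwa [hηd])
    rw [← hπ1] at h1
    rw [← hπ2] at h2
    filter_upwards [ae_of_ae_map measurable_fst.aemeasurable h1,
      ae_of_ae_map measurable_snd.aemeasurable h2] with q hq1 hq2
    rw [Kernel.parallelComp_apply]
    filter_upwards [Measure.quasiMeasurePreserving_fst.ae hq1,
      Measure.quasiMeasurePreserving_snd.ae hq2] with r hr1 hr2
    exact hδ _ _ hr1 hr2
  have hint : ∀ (θ : Measure (X × Y)) [IsProbabilityMeasure θ], Integrable c θ := fun θ _ =>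
    hc.integrable_of_hasCompactSupport (HasCompactSupport.of_compactSpace c)
  have hfst : ρ.map Prod.fst = π := Measure.fst_compProd π _
  have hprob' : IsProbabilityMeasure (ρ.map Prod.snd) :=
    Measure.isProbabilityMeasure_map measurable_snd.aemeasurable
  refine ⟨ρ.map Prod.snd, ⟨hprob', ?_, ?_⟩, ?_⟩
  · ext A hA
    rw [Measure.map_apply measurable_fst hA,
      Measure.map_apply measurable_snd (measurable_fst hA), ← Set.univ_prod,
      ← Set.prod_univ, hρ, Measure.compProd_apply_prod .univ (hA.prod .univ),
      setLIntegral_univ, Measure.snd_apply hA, ← hγd, ← Set.univ_prod,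
      Measure.compProd_apply_prod .univ hA, setLIntegral_univ, ← hπ1,
      lintegral_map (κ.measurable_coe hA) measurable_fst]
    simp [Kernel.parallelComp_apply]
  · ext A hA
    rw [Measure.map_apply measurable_snd hA,
      Measure.map_apply measurable_snd (measurable_snd hA), ← Set.univ_prod,
      ← Set.univ_prod, hρ, Measure.compProd_apply_prod .univ (MeasurableSet.univ.prod hA),
      setLIntegral_univ, Measure.snd_apply hA, ← hηd, ← Set.univ_prod,
      Measure.compProd_apply_prod .univ hA, setLIntegral_univ, ← hπ2,
      lintegral_map (l.measurable_coe hA) measurable_snd]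
    simp [Kernel.parallelComp_apply]
  · have hi1 : Integrable (fun r => c r.1) ρ :=
      (hfst ▸ hint π : Integrable c (ρ.map Prod.fst)).comp_measurable measurable_fst
    have hi2 : Integrable (fun r => c r.2) ρ :=
      (hint (ρ.map Prod.snd)).comp_measurable measurable_snd
    calc ∫ q, c q ∂(ρ.map Prod.snd) = ∫ r, c r.2 ∂ρ :=
          integral_map measurable_snd.aemeasurable hc.aestronglyMeasurable
      _ ≤ ∫ r, (c r.1 + ε) ∂ρ := integral_mono_ae hi2 (hi1.add (integrable_const ε)) hclose
      _ = ∫ r, c r.1 ∂ρ + ε := by rw [integral_add hi1 (integrable_const ε)]; simp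
      _ = ∫ q, c q ∂π + ε := by
          conv_rhs => rw [← hfst]
          rw [integral_map measurable_fst.aemeasurable hc.aestronglyMeasurable]

theorem Plans.nonempty {X Y : Type*} [MeasurableSpace X] [MeasurableSpace Y]
    (μ : Measure X) (ν : Measure Y) [IsProbabilityMeasure μ] [IsProbabilityMeasure ν] :
    (Plans μ ν).Nonempty :=
  ⟨μ.prod ν, inferInstance, by simp [Measure.map_fst_prod], by simp [Measure.map_snd_prod]⟩

/-- The optimal transport cost changes by at most `ε` along couplings concentrated near the
diagonal. -/
theorem Tcost_snd_le_add {X Y : Type*} [MetricSpace X] [MetricSpace Y]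
    [CompactSpace X] [CompactSpace Y]
    [MeasurableSpace X] [BorelSpace X] [MeasurableSpace Y] [BorelSpace Y]
    {c : X × Y → ℝ} (hc : Continuous c) (hc0 : ∀ q, 0 ≤ c q) {δ ε : ℝ}
    (hδ : ∀ q q' : X × Y, dist q.1 q'.1 < δ → dist q.2 q'.2 < δ → c q ≤ c q' + ε)
    {γ : Measure (X × X)} {η : Measure (Y × Y)} [IsProbabilityMeasure γ] [IsProbabilityMeasure η]
    (hγ : ∀ᵐ p ∂γ, dist p.2 p.1 < δ) (hη : ∀ᵐ p ∂η, dist p.2 p.1 < δ) :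
    Tcost c γ.snd η.snd ≤ Tcost c γ.fst η.fst + ε := by
  rw [← sub_le_iff_le_add]
  obtain ⟨π₀, hπ₀⟩ := Plans.nonempty γ.fst η.fst
  refine le_csInf ⟨_, π₀, hπ₀, rfl⟩ ?_
  rintro _ ⟨π, hπ, rfl⟩
  obtain ⟨π', hπ', hle⟩ := exists_plan_integral_le hc hδ hγ hη hπ
  have hbdd : BddBelow {t : ℝ | ∃ π ∈ Plans γ.snd η.snd, t = ∫ q, c q ∂π} := by
    refine ⟨0, ?_⟩
    rintro _ ⟨π, -, rfl⟩
    exact integral_nonneg hc0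
  have : Tcost c γ.snd η.snd ≤ ∫ q, c q ∂π' := csInf_le hbdd ⟨π', hπ', rfl⟩
  linarith

theorem ae_map_prodMk_dist_lt {Z : Type*} [MetricSpace Z] [CompactSpace Z] [MeasurableSpace Z]
    [BorelSpace Z] (τ : Measure Z) {f g : Z → Z} (hf : Measurable f) (hg : Measurable g) {δ : ℝ}
    (h : ∀ z, dist (g z) (f z) < δ) :
    ∀ᵐ z ∂(τ.map fun z => (f z, g z)), dist z.2 z.1 < δ :=
  (ae_map_iff (hf.prodMk hg).aemeasurable
    (measurableSet_lt (by fun_prop) (by fun_prop))).2 (ae_of_all _ h)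

theorem Tcost_map_le_add {X Y : Type*} [MetricSpace X] [MetricSpace Y]
    [CompactSpace X] [CompactSpace Y]
    [MeasurableSpace X] [BorelSpace X] [MeasurableSpace Y] [BorelSpace Y]
    {c : X × Y → ℝ} (hc : Continuous c) (hc0 : ∀ q, 0 ≤ c q) {δ ε : ℝ}
    (hδ : ∀ q q' : X × Y, dist q.1 q'.1 < δ → dist q.2 q'.2 < δ → c q ≤ c q' + ε)
    (μ : Measure X) (ν : Measure Y) [IsProbabilityMeasure μ] [IsProbabilityMeasure ν]
    {f f' : X → X} {g g' : Y → Y} (hf : Measurable f) (hf' : Measurable f')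
    (hg : Measurable g) (hg' : Measurable g')
    (hff' : ∀ x, dist (f' x) (f x) < δ) (hgg' : ∀ y, dist (g' y) (g y) < δ) :
    Tcost c (μ.map f') (ν.map g') ≤ Tcost c (μ.map f) (ν.map g) + ε := by
  have hμ := Measure.isProbabilityMeasure_map (μ := μ) (hf.prodMk hf').aemeasurable
  have hν := Measure.isProbabilityMeasure_map (μ := ν) (hg.prodMk hg').aemeasurable
  have h := Tcost_snd_le_add hc hc0 hδ (ae_map_prodMk_dist_lt μ hf hf' hff')
    (ae_map_prodMk_dist_lt ν hg hg' hgg')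
  rwa [Measure.fst_map_prodMk hf', Measure.fst_map_prodMk hg', Measure.snd_map_prodMk hf,
    Measure.snd_map_prodMk hg] at h

theorem IsVoronoi.dist_le_fillDist {X : Type*} [MetricSpace X] [CompactSpace X] {m : ℕ}
    {s : Fin m → X} {V : Fin m → Set X} (hV : IsVoronoi s V) {x : X} {i : Fin m} (hx : x ∈ V i) :
    dist x (s i) ≤ fillDist s := by
  have hmin : ∀ j, dist x (s i) ≤ dist x (s j) := fun j => by
    rcases eq_or_ne j i with rfl | h
    · exact le_rfl
    · exact (hV.2.2 i).2 hx j h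
  rcases dist_nonneg.eq_or_lt' (a := dist x (s i)) with h | h
  · rw [h]
    exact Real.sSup_nonneg fun r hr => hr.1.le
  · refine le_csSup ⟨Metric.diam (Set.univ : Set X), ?_⟩ ⟨h, x, hmin⟩
    rintro r ⟨-, y, hy⟩
    exact (hy i).trans (Metric.dist_le_diam_of_mem isCompact_univ.isBounded
      (Set.mem_univ _) (Set.mem_univ _))

/-- Sending each Voronoi cell to its centre transports `μ` to its discretization while moving
points by at most the fill distance. -/
theorem IsVoronoi.exists_map_eq_discMeas {X : Type*} [MetricSpace X] [CompactSpace X]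
    [MeasurableSpace X] (μ : Measure X) {m : ℕ} {s : Fin m → X}
    {V : Fin m → Set X} (hV : IsVoronoi s V) (hm : ∀ i, MeasurableSet (V i)) :
    ∃ p : X → X, Measurable p ∧ μ.map p = discMeas μ s V ∧ ∀ x, dist x (p x) ≤ fillDist s := by
  have hcov : ∀ x, ∃ i, x ∈ V i := fun x => Set.mem_iUnion.1 (hV.2.1 ▸ Set.mem_univ x)
  choose f hf using hcov
  have hpre : ∀ i, f ⁻¹' {i} = V i := fun i => by
    ext x
    refine ⟨fun h => h ▸ hf x, fun h => ?_⟩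
    by_contra hne
    exact Set.disjoint_left.1 (hV.1 hne) (hf x) h
  have hfm : Measurable f := measurable_to_countable' fun i => hpre i ▸ hm i
  have hs : Measurable s := measurable_of_countable s
  refine ⟨s ∘ f, hs.comp hfm, ?_, fun x => hV.dist_le_fillDist (hf x)⟩
  rw [← Measure.map_map hs hfm]
  ext A hA
  rw [Measure.map_apply hs hA, ← Measure.sum_smul_dirac (μ.map f), discMeas]
  simp [Measure.map_apply hfm, hpre, Measure.dirac_apply', hA, Set.indicator]
  rfl

/-- Theorem D.5 (A): for a uniformly continuous cost on compact metric spaces, the discrete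
optimal transport cost `T_c(μ_S, ν_T)` converges to `T_c(μ, ν)` as the fill distances of the
sample sets tend to zero. -/
theorem transport_cost_convergence
    {X Y : Type*} [MetricSpace X] [MetricSpace Y] [CompactSpace X] [CompactSpace Y]
    [MeasurableSpace X] [BorelSpace X] [MeasurableSpace Y] [BorelSpace Y]
    (μ : Measure X) (ν : Measure Y) [IsProbabilityMeasure μ] [IsProbabilityMeasure ν]
    (c : X × Y → ℝ) (hc : UniformContinuous c) (hc0 : ∀ q, 0 ≤ c q)
    (ε : ℝ) (hε : 0 < ε) :
    ∃ δ > 0, ∀ (m n : ℕ) (s : Fin m → X) (t : Fin n → Y)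
      (V : Fin m → Set X) (W : Fin n → Set Y),
      IsVoronoi s V → IsVoronoi t W →
      (∀ i, MeasurableSet (V i)) → (∀ j, MeasurableSet (W j)) →
      max (fillDist s) (fillDist t) < δ →
      |Tcost c μ ν - Tcost c (discMeas μ s V) (discMeas ν t W)| ≤ ε := by
  obtain ⟨δ, hδ, hcδ⟩ := Metric.uniformContinuous_iff.1 hc ε hε
  have hle : ∀ q q' : X × Y, dist q.1 q'.1 < δ → dist q.2 q'.2 < δ → c q ≤ c q' + ε := by
    intro q q' h1 h2
    have := hcδ (a := q) (b := q') (by rw [Prod.dist_eq]; exact max_lt h1 h2)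
    rw [Real.dist_eq] at this
    linarith [(abs_lt.1 this).2]
  refine ⟨δ, hδ, fun m n s t V W hV hW hVm hWm hlt => ?_⟩
  obtain ⟨p, hp, hpμ, hpd⟩ := hV.exists_map_eq_discMeas μ hVm
  obtain ⟨r, hr, hrν, hrd⟩ := hW.exists_map_eq_discMeas ν hWm
  replace hpd x := (hpd x).trans_lt ((le_max_left _ _).trans_lt hlt)
  replace hrd y := (hrd y).trans_lt ((le_max_right _ _).trans_lt hlt)
  rw [← hpμ, ← hrν]
  have h₁ := Tcost_map_le_add hc.continuous hc0 hle μ ν hp measurable_id hr measurable_id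
    (fun x => hpd x) (fun y => hrd y)
  have h₂ := Tcost_map_le_add hc.continuous hc0 hle μ ν measurable_id hp measurable_id hr
    (fun x => dist_comm x (p x) ▸ hpd x) (fun y => dist_comm y (r y) ▸ hrd y)
  rw [Measure.map_id, Measure.map_id] at h₁ h₂
  rw [abs_sub_le_iff]
  constructor <;> linarith
end

section
/- Let (X, d_X) and (Y, d_Y) be compact metric spaces with Borel probability measures μ and ν, and let c : X × Y → [0, ∞) satisfy the Lipschitz condition |c(x, y) − c(x′, y′)| ≤ λ (d_X(x, x′) + d_Y(y, y′)) for all x, x′ ∈ X, y, y′ ∈ Y. Let S ⊆ X and T ⊆ Y be finite sets with measurable Voronoi cells, discrete measures μ_S and ν_T, and h = max(φ_X(S), φ_Y(T)). Then |T_c(μ, ν) − T_c(μ_S, ν_T)| ≤ 2λh. -/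
open MeasureTheory

section

open ProbabilityTheory

/-- Joint law of a point `z` sampled from `π` and a pair sampled from `κ z.1 × η z.2`:
its projection to the first coordinates only sees `κ`. -/
lemma map_compProd_parallelComp_fst {A B C D : Type*} [MeasurableSpace A] [MeasurableSpace B]
    [MeasurableSpace C] [MeasurableSpace D] (π : Measure (A × B)) [IsProbabilityMeasure π]
    (κ : Kernel A C) (η : Kernel B D) [IsMarkovKernel κ] [IsMarkovKernel η] :
    (π ⊗ₘ (κ ∥ₖ η)).map (fun z => (z.1.1, z.2.1)) = (π.map Prod.fst) ⊗ₘ κ := by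
  have : IsProbabilityMeasure (π.map Prod.fst) :=
    Measure.isProbabilityMeasure_map measurable_fst.aemeasurable
  refine Measure.ext_of_lintegral _ fun f hf => ?_
  rw [lintegral_map hf (by fun_prop), Measure.lintegral_compProd (by fun_prop),
    Measure.lintegral_compProd hf, lintegral_map (hf.lintegral_kernel_prod_right') measurable_fst]
  refine lintegral_congr fun z => ?_
  rw [Kernel.parallelComp_apply, lintegral_prod _ (by fun_prop)]
  simp

/-- The analogue of `map_compProd_parallelComp_fst` for the second coordinates. -/
lemma map_compProd_parallelComp_snd {A B C D : Type*} [MeasurableSpace A] [MeasurableSpace B]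
    [MeasurableSpace C] [MeasurableSpace D] (π : Measure (A × B)) [IsProbabilityMeasure π]
    (κ : Kernel A C) (η : Kernel B D) [IsMarkovKernel κ] [IsMarkovKernel η] :
    (π ⊗ₘ (κ ∥ₖ η)).map (fun z => (z.1.2, z.2.2)) = (π.map Prod.snd) ⊗ₘ η := by
  have : IsProbabilityMeasure (π.map Prod.snd) :=
    Measure.isProbabilityMeasure_map measurable_snd.aemeasurable
  refine Measure.ext_of_lintegral _ fun f hf => ?_
  rw [lintegral_map hf (by fun_prop), Measure.lintegral_compProd (by fun_prop),
    Measure.lintegral_compProd hf, lintegral_map (hf.lintegral_kernel_prod_right') measurable_snd]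
  refine lintegral_congr fun z => ?_
  rw [Kernel.parallelComp_apply, lintegral_prod _ (by fun_prop)]
  simp

/-- Disintegration of `μ` along a measurable map `p`. -/
lemma exists_kernel_map_compProd_eq {A C : Type*} [MeasurableSpace A] [MeasurableSpace C]
    [StandardBorelSpace A] (μ : Measure A) [IsProbabilityMeasure μ] {p : A → C}
    (hp : Measurable p) :
    ∃ κ : Kernel C A, IsMarkovKernel κ ∧ (μ.map p) ⊗ₘ κ = μ.map (fun x => (p x, x)) := by
  have : Nonempty A := nonempty_of_isProbabilityMeasure μ
  have : IsProbabilityMeasure (μ.map fun x => (p x, x)) :=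
    Measure.isProbabilityMeasure_map (by fun_prop)
  refine ⟨(μ.map fun x => (p x, x)).condKernel, inferInstance, ?_⟩
  have h : (μ.map fun x => (p x, x)).fst = μ.map p := by
    rw [Measure.fst, Measure.map_map measurable_fst (by fun_prop)]
    rfl
  rw [← h]
  exact Measure.disintegrate _ _

lemma map_prodMap_mem_Plans {X Y X' Y' : Type*} [MeasurableSpace X] [MeasurableSpace Y]
    [MeasurableSpace X'] [MeasurableSpace Y'] {μ : Measure X} {ν : Measure Y}
    {p : X → X'} {q : Y → Y'} (hp : Measurable p) (hq : Measurable q) {π : Measure (X × Y)}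
    (hπ : π ∈ Plans μ ν) : π.map (Prod.map p q) ∈ Plans (μ.map p) (ν.map q) := by
  obtain ⟨h, rfl, rfl⟩ := hπ
  refine ⟨Measure.isProbabilityMeasure_map (by fun_prop), ?_, ?_⟩
  · rw [Measure.map_map measurable_fst (by fun_prop), Measure.map_map hp measurable_fst]
    rfl
  · rw [Measure.map_map measurable_snd (by fun_prop), Measure.map_map hq measurable_snd]
    rfl

/-- Every plan between the push-forwards lifts to a plan between the original measures. -/
lemma exists_mem_Plans_map_prodMap_eq {X Y X' Y' : Type*} [MeasurableSpace X]
    [MeasurableSpace Y] [MeasurableSpace X'] [MeasurableSpace Y'] [StandardBorelSpace X]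
    [StandardBorelSpace Y] [MeasurableEq X'] [MeasurableEq Y']
    (μ : Measure X) (ν : Measure Y)
    [IsProbabilityMeasure μ] [IsProbabilityMeasure ν] {p : X → X'} {q : Y → Y'}
    (hp : Measurable p) (hq : Measurable q) {π' : Measure (X' × Y')}
    (hπ' : π' ∈ Plans (μ.map p) (ν.map q)) :
    ∃ π ∈ Plans μ ν, π.map (Prod.map p q) = π' := by
  obtain ⟨h, h1, h2⟩ := hπ'
  obtain ⟨κ, _, hκ⟩ := exists_kernel_map_compProd_eq μ hp
  obtain ⟨η, _, hη⟩ := exists_kernel_map_compProd_eq ν hq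
  have e1 := map_compProd_parallelComp_fst π' κ η
  have e2 := map_compProd_parallelComp_snd π' κ η
  rw [h1, hκ] at e1
  rw [h2, hη] at e2
  set M := π' ⊗ₘ (κ ∥ₖ η) with hM
  have a1 : ∀ᵐ z ∂M, p z.2.1 = z.1.1 := by
    have : ∀ᵐ z ∂(M.map fun z => (z.1.1, z.2.1)), p z.2 = z.1 := by
      rw [e1, ae_map_iff (by fun_prop) (measurableSet_eq_fun (by fun_prop) measurable_fst)]
      exact Filter.Eventually.of_forall fun _ => rfl
    exact ae_of_ae_map (by fun_prop) this
  have a2 : ∀ᵐ z ∂M, q z.2.2 = z.1.2 := by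
    have : ∀ᵐ z ∂(M.map fun z => (z.1.2, z.2.2)), q z.2 = z.1 := by
      rw [e2, ae_map_iff (by fun_prop) (measurableSet_eq_fun (by fun_prop) measurable_fst)]
      exact Filter.Eventually.of_forall fun _ => rfl
    exact ae_of_ae_map (by fun_prop) this
  refine ⟨M.map Prod.snd, ⟨Measure.isProbabilityMeasure_map (by fun_prop), ?_, ?_⟩, ?_⟩
  · have := congrArg (Measure.map Prod.snd) e1
    rw [Measure.map_map (by fun_prop) (by fun_prop),
      Measure.map_map (by fun_prop) (by fun_prop)] at this
    rw [Measure.map_map (by fun_prop) (by fun_prop)]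
    exact this.trans Measure.map_id
  · have := congrArg (Measure.map Prod.snd) e2
    rw [Measure.map_map (by fun_prop) (by fun_prop),
      Measure.map_map (by fun_prop) (by fun_prop)] at this
    rw [Measure.map_map (by fun_prop) (by fun_prop)]
    exact this.trans Measure.map_id
  · rw [Measure.map_map (by fun_prop) (by fun_prop)]
    have : (Prod.map p q ∘ Prod.snd) =ᵐ[M] Prod.fst := by
      filter_upwards [a1, a2] with z h h'
      exact Prod.ext h h'
    rw [Measure.map_congr this]
    exact Measure.fst_compProd _ _

/-- Moving both measures by maps that change the cost by at most `K` changes the optimal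
transport cost by at most `K`. -/
lemma abs_Tcost_sub_Tcost_map_le {X Y : Type*} [MeasurableSpace X]
    [MeasurableSpace Y] [StandardBorelSpace X] [StandardBorelSpace Y]
    (μ : Measure X) (ν : Measure Y) [IsProbabilityMeasure μ] [IsProbabilityMeasure ν]
    {c : X × Y → ℝ} (hc : Measurable c) (hc0 : ∀ z, 0 ≤ c z) {B : ℝ} (hB : ∀ z, c z ≤ B)
    {p : X → X} {q : Y → Y} (hp : Measurable p) (hq : Measurable q) {K : ℝ}
    (hK : ∀ z, |c z - c (Prod.map p q z)| ≤ K) :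
    |Tcost c μ ν - Tcost c (μ.map p) (ν.map q)| ≤ K := by
  have key : ∀ π : Measure (X × Y), IsProbabilityMeasure π →
      |∫ z, c z ∂π - ∫ z, c z ∂(π.map (Prod.map p q))| ≤ K := by
    intro π _
    have hi : ∀ r : X × Y → X × Y, Measurable r → Integrable (fun z => c (r z)) π :=
      fun r hr => Integrable.of_bound (hc.comp hr).aestronglyMeasurable B
        (Filter.Eventually.of_forall fun z => by
          rw [Real.norm_eq_abs, abs_of_nonneg (hc0 _)]
          exact hB _)
    rw [integral_map (by fun_prop) hc.aestronglyMeasurable,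
      ← integral_sub (by simpa using hi id measurable_id) (hi _ (hp.prodMap hq))]
    simpa using norm_integral_le_of_norm_le_const (μ := π)
      (f := fun z => c z - c (Prod.map p q z)) (Filter.Eventually.of_forall hK)
  have bdd : ∀ (α : Measure X) (β : Measure Y),
      BddBelow {t : ℝ | ∃ π ∈ Plans α β, t = ∫ z, c z ∂π} := by
    rintro α β
    refine ⟨0, ?_⟩
    rintro _ ⟨π, -, rfl⟩
    exact integral_nonneg hc0
  have hprod : μ.prod ν ∈ Plans μ ν := ⟨inferInstance, by simp, by simp⟩
  rw [abs_sub_le_iff]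
  constructor
  · rw [sub_le_comm]
    refine le_csInf ⟨_, _, map_prodMap_mem_Plans hp hq hprod, rfl⟩ ?_
    rintro _ ⟨π', hπ', rfl⟩
    obtain ⟨π, hπ, rfl⟩ := exists_mem_Plans_map_prodMap_eq μ ν hp hq hπ'
    have h1 : Tcost c μ ν ≤ ∫ z, c z ∂π := csInf_le (bdd _ _) ⟨π, hπ, rfl⟩
    have h2 := abs_sub_le_iff.1 (key π hπ.1)
    linarith
  · rw [sub_le_comm]
    refine le_csInf ⟨_, _, hprod, rfl⟩ ?_
    rintro _ ⟨π, hπ, rfl⟩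
    have h1 : Tcost c (μ.map p) (ν.map q) ≤ ∫ z, c z ∂(π.map (Prod.map p q)) :=
      csInf_le (bdd _ _) ⟨_, map_prodMap_mem_Plans hp hq hπ, rfl⟩
    have h2 := abs_sub_le_iff.1 (key π hπ.1)
    linarith

/-- A Voronoi collection of measurable cells gives a measurable nearest-point map, whose
displacement is bounded by the fill distance and which pushes `μ` to its discretization. -/
lemma IsVoronoi.exists_projection {X : Type*} [MetricSpace X] [CompactSpace X]
    [MeasurableSpace X] {m : ℕ} {s : Fin m → X} {V : Fin m → Set X}
    (hV : IsVoronoi s V) (hVm : ∀ i, MeasurableSet (V i)) (μ : Measure X) :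
    ∃ p : X → X, Measurable p ∧ (∀ x, p x ∈ Set.range s) ∧
      (∀ x, dist x (p x) ≤ fillDist s) ∧ μ.map p = discMeas μ s V := by
  obtain ⟨hd, hu, hO⟩ := hV
  have hcov : ∀ x, ∃ i, x ∈ V i := fun x => Set.mem_iUnion.1 (hu ▸ Set.mem_univ x)
  choose f hf using hcov
  have hfi : ∀ x i, x ∈ V i ↔ f x = i := by
    refine fun x i => ⟨fun hx => ?_, fun h => h ▸ hf x⟩
    by_contra hne
    exact Set.disjoint_left.1 (hd hne) (hf x) hx
  have hpre : ∀ i, f ⁻¹' {i} = V i := fun i => Set.ext fun x => (hfi x i).symm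
  have hfm : Measurable f := measurable_to_countable' fun i => by rw [hpre]; exact hVm i
  refine ⟨s ∘ f, (measurable_of_finite s).comp hfm,
    fun x => ⟨f x, rfl⟩, fun x => ?_, ?_⟩
  · rcases (dist_nonneg : 0 ≤ dist x ((s ∘ f) x)).eq_or_lt with h0 | h0
    · rw [← h0]
      exact Real.sSup_nonneg fun r hr => hr.1.le
    · refine le_csSup ⟨Metric.diam (Set.univ : Set X), ?_⟩ ⟨h0, x, fun i => ?_⟩
      · rintro r ⟨-, y, hy⟩
        exact (hy (f x)).trans
          (Metric.dist_le_diam_of_mem isCompact_univ.isBounded trivial trivial)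
      · by_cases hi : i = f x
        · rw [hi]
          rfl
        · exact (hO (f x)).2 (hf x) i hi
  · ext A hA
    rw [← Measure.map_map (measurable_of_finite s) hfm,
      Measure.map_apply (measurable_of_finite s) hA, ← Measure.sum_smul_dirac (μ.map f),
      Measure.sum_fintype, discMeas]
    simp only [Measure.finsetSum_apply, Measure.smul_apply, Measure.dirac_apply' _ hA,
      Measure.dirac_apply' _ (measurable_of_finite s hA),
      Measure.map_apply hfm (measurableSet_singleton _), hpre]
    rfl

end

/-- Theorem D.5 (B): for a cost `c` that is Lipschitz with constant `λ` (w.r.t. the sum of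
the two distances) on compact metric spaces, `|T_c(μ, ν) - T_c(μ_S, ν_T)| ≤ 2λh`, where
`h = max(φ_X(S), φ_Y(T))`. -/
theorem transport_cost_lipschitz_approx
    {X Y : Type*} [MetricSpace X] [MetricSpace Y] [CompactSpace X] [CompactSpace Y]
    [MeasurableSpace X] [BorelSpace X] [MeasurableSpace Y] [BorelSpace Y]
    (μ : Measure X) (ν : Measure Y) [IsProbabilityMeasure μ] [IsProbabilityMeasure ν]
    (c : X × Y → ℝ) (hc0 : ∀ q, 0 ≤ c q) (lam : ℝ)
    (hcL : ∀ (x x' : X) (y y' : Y),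
      |c (x, y) - c (x', y')| ≤ lam * (dist x x' + dist y y'))
    {m n : ℕ} (s : Fin m → X) (t : Fin n → Y)
    (V : Fin m → Set X) (W : Fin n → Set Y)
    (hVvor : IsVoronoi s V) (hWvor : IsVoronoi t W)
    (hVm : ∀ i, MeasurableSet (V i)) (hWm : ∀ j, MeasurableSet (W j)) :
    |Tcost c μ ν - Tcost c (discMeas μ s V) (discMeas ν t W)|
      ≤ 2 * lam * max (fillDist s) (fillDist t) := by
  have : SecondCountableTopology X := EMetric.secondCountable_of_sigmaCompact X
  have : SecondCountableTopology Y := EMetric.secondCountable_of_sigmaCompact Y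
  obtain ⟨p, hp, hps, hpd, hpμ⟩ := hVvor.exists_projection hVm μ
  obtain ⟨q, hq, hqs, hqd, hqν⟩ := hWvor.exists_projection hWm ν
  have hcont : Continuous c := by
    refine (LipschitzWith.of_dist_le_mul (K := ⟨|lam| * 2, by positivity⟩) fun z w => ?_).continuous
    have h1 : dist z.1 w.1 ≤ dist z w := le_max_left _ _
    have h2 : dist z.2 w.2 ≤ dist z w := le_max_right _ _
    calc dist (c z) (c w) ≤ lam * (dist z.1 w.1 + dist z.2 w.2) := hcL z.1 w.1 z.2 w.2
      _ ≤ |lam| * (dist z.1 w.1 + dist z.2 w.2) := by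
        gcongr
        exact le_abs_self lam
      _ ≤ |lam| * (dist z w + dist z w) := by gcongr
      _ = |lam| * 2 * dist z w := by ring
  obtain ⟨B, hB⟩ := (isCompact_range hcont).bddAbove
  rw [← hpμ, ← hqν]
  refine abs_Tcost_sub_Tcost_map_le μ ν hcont.measurable hc0
    (fun z => hB (Set.mem_range_self z)) hp hq fun z => ?_
  have hz := hcL z.1 (p z.1) z.2 (q z.2)
  have h1 := (hpd z.1).trans (le_max_left _ (fillDist t))
  have h2 := (hqd z.2).trans (le_max_right (fillDist s) _)
  refine hz.trans ?_
  rcases le_or_gt 0 lam with hl | hl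
  · nlinarith
  · have hd : ∀ (x x' : X) (y y' : Y), dist x x' + dist y y' ≤ 0 := fun x x' y y' =>
      nonpos_of_mul_nonneg_right ((abs_nonneg _).trans (hcL x x' y y')) hl
    have hs : fillDist s ≤ 0 := Real.sSup_nonpos fun r hr => by
      obtain ⟨-, x, hx⟩ := hr
      obtain ⟨i, -⟩ := hps x
      simpa using (hx i).trans (by simpa using hd x (s i) z.2 z.2)
    have ht : fillDist t ≤ 0 := Real.sSup_nonpos fun r hr => by
      obtain ⟨-, y, hy⟩ := hr
      obtain ⟨j, -⟩ := hqs y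
      simpa using (hy j).trans (by simpa using hd z.1 z.1 y (t j))
    have h3 : dist z.1 (p z.1) + dist z.2 (q z.2) ≥ 0 := by positivity
    nlinarith [max_le hs ht]
end
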